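/- arXiv:2111.08117 — 3 statements merged into one kernel-verified Lean document; each statement's English description precedes it below -/
import Mathlib

section
/- For every n ≥ 1 and every piecewise constant function f : ℝ^n → ℝ, there exists a linear threshold neural network with input dimension n and exactly 2 hidden layers that computes f exactly, and such a network can be chosen with size at most 3·|𝒫*_f|. -/
open Finset MeasureTheory

noncomputable section

/-- The threshold activation function. -/
def thresh (t : ℝ) : ℝ := if 0 < t then 1 else 0

/-- `T` is an affine map from `ℝ^a` to `ℝ^b`. -/
def IsAffineMap {a b : ℕ} (T : (Fin a → ℝ) → (Fin b → ℝ)) : Prop :=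
  ∃ (M : Fin b → Fin a → ℝ) (c : Fin b → ℝ),
    ∀ x j, T x j = (∑ i, M j i * x i) + c j

/-- `Hidden n k s w g` : `g = σ ∘ T_k ∘ ⋯ ∘ σ ∘ T_1 : ℝ^n → ℝ^w` is the function computed
by `k` hidden threshold layers, where the last hidden layer has width `w` and the total
number of hidden neurons (the size) is `s`. -/
inductive Hidden (n : ℕ) : ℕ → ℕ → (w : ℕ) → ((Fin n → ℝ) → (Fin w → ℝ)) → Prop
  | single {w : ℕ} (T : (Fin n → ℝ) → (Fin w → ℝ)) (hT : IsAffineMap T) :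
      Hidden n 1 w w (fun x j => thresh (T x j))
  | comp {k s w w' : ℕ} {g : (Fin n → ℝ) → (Fin w → ℝ)}
      (T : (Fin w → ℝ) → (Fin w' → ℝ)) (hg : Hidden n k s w g) (hT : IsAffineMap T) :
      Hidden n (k + 1) (s + w') w' (fun x j => thresh (T (g x) j))

/-- `f : ℝ^n → ℝ` is computed by a linear threshold neural network with `k` hidden layers
and size (number of hidden neurons) `s`. -/
def LTComputes (n k s : ℕ) (f : (Fin n → ℝ) → ℝ) : Prop :=
  ∃ (w : ℕ) (g : (Fin n → ℝ) → (Fin w → ℝ)) (a : Fin w → ℝ) (c : ℝ),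
    Hidden n k s w g ∧ ∀ x, f x = (∑ j, a j * g x j) + c

/-- A polyhedron in `ℝ^n`: the intersection of finitely many closed halfspaces. -/
def IsPolyhedron {n : ℕ} (P : Set (Fin n → ℝ)) : Prop :=
  ∃ (m : ℕ) (a : Fin m → Fin n → ℝ) (b : Fin m → ℝ),
    P = {x | ∀ i, (∑ j, a i j * x j) ≤ b i}

/-- `F` is a face of the polyhedron `P`. -/
def IsFace {n : ℕ} (F P : Set (Fin n → ℝ)) : Prop :=
  ∃ (c : Fin n → ℝ) (d : ℝ),
    (∀ x ∈ P, (∑ j, c j * x j) ≤ d) ∧ F = {x ∈ P | (∑ j, c j * x j) = d}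

/-- A (finite) polyhedral complex in `ℝ^n`. -/
def IsPolyhedralComplex {n : ℕ} (Pc : Finset (Set (Fin n → ℝ))) : Prop :=
  (∀ P ∈ Pc, IsPolyhedron P) ∧
  (∀ P ∈ Pc, ∀ Q ∈ Pc, IsFace (P ∩ Q) P ∧ IsFace (P ∩ Q) Q) ∧
  (∀ P ∈ Pc, ∀ F, IsFace F P → F ∈ Pc)

/-- The union of the members of `Pc` is all of `ℝ^n`. -/
def Covers {n : ℕ} (Pc : Finset (Set (Fin n → ℝ))) : Prop :=
  ⋃₀ (Pc : Set (Set (Fin n → ℝ))) = Set.univ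

/-- The dimension of a polyhedron: the dimension of its affine hull. -/
def polyDim {n : ℕ} (P : Set (Fin n → ℝ)) : ℕ :=
  Module.finrank ℝ (affineSpan ℝ P).direction

/-- `Pc` is a polyhedral complex covering `ℝ^n` with which `f` is compatible as a piecewise
constant function: `f` is constant on the relative interior of each member of `Pc`. -/
def CompatiblePWC {n : ℕ} (f : (Fin n → ℝ) → ℝ) (Pc : Finset (Set (Fin n → ℝ))) : Prop :=
  IsPolyhedralComplex Pc ∧ Covers Pc ∧
    ∀ P ∈ Pc, ∃ c : ℝ, ∀ x ∈ intrinsicInterior ℝ P, f x = c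

/-- `f : ℝ^n → ℝ` is piecewise constant. -/
def IsPWC {n : ℕ} (f : (Fin n → ℝ) → ℝ) : Prop := ∃ Pc, CompatiblePWC f Pc

/-- The cardinality `|Pc*_f|` of a minimum-cardinality polyhedral complex compatible with `f`. -/
def minCardPWC {n : ℕ} (f : (Fin n → ℝ) → ℝ) : ℕ :=
  sInf {c : ℕ | ∃ Pc, CompatiblePWC f Pc ∧ Pc.card = c}

open scoped Matrix

section Polyhedra

variable {n : ℕ}

/-- The polyhedron cut out by a finite set of inequalities `p.1 ⬝ᵥ x ≤ p.2`. -/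
def halfspaceInter (T : Finset ((Fin n → ℝ) × ℝ)) : Set (Fin n → ℝ) :=
  {x | ∀ p ∈ T, p.1 ⬝ᵥ x ≤ p.2}

lemma IsPolyhedron.exists_halfspaceInter {P : Set (Fin n → ℝ)} (hP : IsPolyhedron P) :
    ∃ T, P = halfspaceInter T := by
  classical
  obtain ⟨m, a, b, rfl⟩ := hP
  refine ⟨univ.image fun i => (a i, b i), ?_⟩
  ext x
  simp [halfspaceInter, dotProduct]

lemma continuous_dotProduct_left (a : Fin n → ℝ) : Continuous fun x => a ⬝ᵥ x := by
  unfold dotProduct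
  fun_prop

lemma isClosed_halfspaceInter (T : Finset ((Fin n → ℝ) × ℝ)) :
    IsClosed (halfspaceInter T) := by
  have : halfspaceInter T = ⋂ p ∈ T, {x | p.1 ⬝ᵥ x ≤ p.2} := by
    ext x; simp [halfspaceInter]
  rw [this]
  exact isClosed_biInter fun p _ =>
    isClosed_le (continuous_dotProduct_left p.1) continuous_const

lemma convex_halfspaceInter (T : Finset ((Fin n → ℝ) × ℝ)) :
    Convex ℝ (halfspaceInter T) := by
  intro x hx y hy s t hs ht hst p hp
  have h1 := mul_le_mul_of_nonneg_left (hx p hp) hs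
  have h2 := mul_le_mul_of_nonneg_left (hy p hp) ht
  simp only [dotProduct_add, dotProduct_smul, smul_eq_mul]
  calc s * p.1 ⬝ᵥ x + t * p.1 ⬝ᵥ y ≤ s * p.2 + t * p.2 := add_le_add h1 h2
    _ = p.2 := by rw [← add_mul, hst, one_mul]

lemma dotProduct_lineMap (a x y : Fin n → ℝ) (t : ℝ) :
    a ⬝ᵥ AffineMap.lineMap x y t = a ⬝ᵥ x + t * (a ⬝ᵥ y - a ⬝ᵥ x) := by
  simp [AffineMap.lineMap_apply, dotProduct_add, dotProduct_smul, dotProduct_sub]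
  ring

lemma exists_neg_lineMap_mem_of_mem_intrinsicInterior {P : Set (Fin n → ℝ)} {x y : Fin n → ℝ}
    (hx : x ∈ intrinsicInterior ℝ P) (hy : y ∈ P) :
    ∃ t < (0 : ℝ), AffineMap.lineMap x y t ∈ P := by
  obtain ⟨x', hx', rfl⟩ := mem_intrinsicInterior.1 hx
  let γ : ℝ → affineSpan ℝ P := fun t =>
    ⟨AffineMap.lineMap (x' : Fin n → ℝ) y t,
      AffineMap.lineMap_mem t x'.2 (subset_affineSpan ℝ P hy)⟩
  have hγ : Continuous γ :=
    Continuous.subtype_mk AffineMap.lineMap_continuous _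
  have h0 : γ 0 = x' := by ext1; simp [γ]
  have hmem : ∀ᶠ t in nhds (0 : ℝ), γ t ∈ interior ((↑) ⁻¹' P : Set (affineSpan ℝ P)) := by
    apply hγ.continuousAt.eventually_mem
    rw [h0]
    exact isOpen_interior.mem_nhds hx'
  obtain ⟨t, ht, ht0⟩ :=
    ((hmem.filter_mono (nhdsWithin_le_nhds (s := Set.Iio 0))).and
      self_mem_nhdsWithin).exists
  exact ⟨t, ht0, (interior_subset ht : γ t ∈ _)⟩

lemma dotProduct_eq_of_mem_intrinsicInterior {P : Set (Fin n → ℝ)} {x y c : Fin n → ℝ} {d : ℝ}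
    (hx : x ∈ intrinsicInterior ℝ P) (hc : ∀ z ∈ P, c ⬝ᵥ z ≤ d) (hcx : c ⬝ᵥ x = d)
    (hy : y ∈ P) : c ⬝ᵥ y = d := by
  obtain ⟨t, ht, hmem⟩ := exists_neg_lineMap_mem_of_mem_intrinsicInterior hx hy
  have h := hc _ hmem
  have hy' := hc _ hy
  rw [dotProduct_lineMap] at h
  nlinarith

lemma IsFace.eq_of_mem_intrinsicInterior {P F : Set (Fin n → ℝ)} {x : Fin n → ℝ}
    (hF : IsFace F P) (hx : x ∈ intrinsicInterior ℝ P) (hxF : x ∈ F) : F = P := by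
  obtain ⟨c, d, hc, rfl⟩ := hF
  exact Set.Subset.antisymm (fun y hy => hy.1)
    fun y hy => ⟨hy, dotProduct_eq_of_mem_intrinsicInterior hx hc hxF.2 hy⟩

lemma mem_intrinsicInterior_halfspaceInter {T : Finset ((Fin n → ℝ) × ℝ)} {x : Fin n → ℝ}
    (hx : x ∈ halfspaceInter T)
    (h : ∀ p ∈ T, p.1 ⬝ᵥ x = p.2 → ∀ y ∈ halfspaceInter T, p.1 ⬝ᵥ y = p.2) :
    x ∈ intrinsicInterior ℝ (halfspaceInter T) := by
  refine mem_intrinsicInterior.2 ⟨⟨x, subset_affineSpan ℝ _ hx⟩, ?_, rfl⟩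
  rw [mem_interior_iff_mem_nhds]
  have key : ∀ p ∈ T, ∀ᶠ z : affineSpan ℝ (halfspaceInter T) in
      nhds ⟨x, subset_affineSpan ℝ _ hx⟩, p.1 ⬝ᵥ (z : Fin n → ℝ) ≤ p.2 := by
    intro p hp
    rcases (hx p hp).lt_or_eq with hlt | heq
    · have hcont : Continuous fun z : affineSpan ℝ (halfspaceInter T) =>
          p.1 ⬝ᵥ (z : Fin n → ℝ) :=
        (continuous_dotProduct_left p.1).comp continuous_subtype_val
      filter_upwards [hcont.continuousAt.eventually_lt continuousAt_const hlt] with z hz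
      exact hz.le
    · refine Filter.Eventually.of_forall fun z => le_of_eq ?_
      refine affineSpan_induction (p := fun z => p.1 ⬝ᵥ z = p.2) z.2 (h p hp heq) ?_
      intro c u v w hu hv hw
      simp [dotProduct_add, dotProduct_smul, dotProduct_sub, hu, hv, hw]
  exact (Filter.eventually_all_finset T).2 key

lemma exists_irredundant_subset (T : Finset ((Fin n → ℝ) × ℝ)) :
    ∃ T' ⊆ T, halfspaceInter T' = halfspaceInter T ∧
      ∀ p ∈ T', ∃ z, p.2 < p.1 ⬝ᵥ z ∧ ∀ q ∈ T', q ≠ p → q.1 ⬝ᵥ z ≤ q.2 := by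
  classical
  induction T using Finset.strongInduction with
  | H T ih =>
    by_cases h : ∀ p ∈ T, ∃ z, p.2 < p.1 ⬝ᵥ z ∧ ∀ q ∈ T, q ≠ p → q.1 ⬝ᵥ z ≤ q.2
    · exact ⟨T, Subset.refl T, rfl, h⟩
    push Not at h
    obtain ⟨p, hp, hz⟩ := h
    obtain ⟨T', hT', heq, hirr⟩ := ih (T.erase p) (erase_ssubset hp)
    refine ⟨T', hT'.trans (erase_subset p T), heq.trans ?_, hirr⟩
    ext z
    refine ⟨fun hzT q hq => ?_, fun hzT q hq => hzT q (mem_of_mem_erase hq)⟩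
    by_cases hqp : q = p
    · subst hqp
      by_contra hlt
      obtain ⟨r, hr, hrq, hrz⟩ := hz z (not_le.1 hlt)
      exact absurd (hzT r (mem_erase.2 ⟨hrq, hr⟩)) (not_le.2 hrz)
    · exact hzT q (mem_erase.2 ⟨hqp, hq⟩)

lemma dotProduct_self_pos_of_ne_zero {a : Fin n → ℝ} (ha : a ≠ 0) : 0 < a ⬝ᵥ a :=
  lt_of_le_of_ne (sum_nonneg fun i _ => mul_self_nonneg (a i))
    fun h => ha (dotProduct_self_eq_zero.1 h.symm)

lemma dotProduct_lt_of_mem_interior {Q : Set (Fin n → ℝ)} {x a : Fin n → ℝ} {b : ℝ}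
    (hx : x ∈ interior Q) (ha : a ≠ 0) (hQ : ∀ y ∈ Q, a ⬝ᵥ y ≤ b) : a ⬝ᵥ x < b := by
  have hcont : Continuous fun t : ℝ => x + t • a := by fun_prop
  have hmem : ∀ᶠ t in nhds (0 : ℝ), x + t • a ∈ Q := by
    apply hcont.continuousAt.eventually_mem
    simpa using mem_interior_iff_mem_nhds.1 hx
  obtain ⟨t, ht, ht0⟩ :=
    ((hmem.filter_mono (nhdsWithin_le_nhds (s := Set.Ioi 0))).and
      self_mem_nhdsWithin).exists
  have h := hQ _ ht
  rw [dotProduct_add, dotProduct_smul, smul_eq_mul] at h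
  have := mul_pos (show 0 < t from ht0) (dotProduct_self_pos_of_ne_zero ha)
  linarith

/-- A hyperplane containing the facet of a full-dimensional polyhedron cut out by an
irredundant inequality is the boundary hyperplane of that inequality. -/
lemma exists_smul_eq_of_facet_subset {T : Finset ((Fin n → ℝ) × ℝ)} {x z : Fin n → ℝ}
    {p : (Fin n → ℝ) × ℝ} (hx : ∀ q ∈ T, q.1 ⬝ᵥ x < q.2) (hp : p ∈ T)
    (hz : p.2 < p.1 ⬝ᵥ z) (hzT : ∀ q ∈ T, q ≠ p → q.1 ⬝ᵥ z ≤ q.2)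
    {c : Fin n → ℝ} {d : ℝ} (hc : c ≠ 0)
    (hcd : ∀ y ∈ halfspaceInter T, p.1 ⬝ᵥ y = p.2 → c ⬝ᵥ y = d) :
    ∃ r : ℝ, r ≠ 0 ∧ p.1 = r • c ∧ p.2 = r * d := by
  have hxp := hx p hp
  have hden : 0 < p.1 ⬝ᵥ z - p.1 ⬝ᵥ x := by linarith
  set t := (p.2 - p.1 ⬝ᵥ x) / (p.1 ⬝ᵥ z - p.1 ⬝ᵥ x) with ht
  have ht0 : 0 < t := div_pos (by linarith) hden
  have ht1 : t < 1 := (div_lt_one hden).2 (by linarith)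
  set y : Fin n → ℝ := AffineMap.lineMap x z t with hy
  have hyp : p.1 ⬝ᵥ y = p.2 := by
    rw [hy, dotProduct_lineMap, ht, div_mul_cancel₀ _ hden.ne']
    ring
  have hyq : ∀ q ∈ T, q ≠ p → q.1 ⬝ᵥ y < q.2 := by
    intro q hq hqp
    rw [hy, dotProduct_lineMap]
    nlinarith [hx q hq, hzT q hq hqp]
  have hyd : c ⬝ᵥ y = d := by
    refine hcd y (fun q hq => ?_) hyp
    by_cases hqp : q = p
    · rw [hqp, hyp]
    · exact (hyq q hq hqp).le
  have hker : ∀ v, p.1 ⬝ᵥ v = 0 → c ⬝ᵥ v = 0 := by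
    intro v hv
    have hmem : ∀ᶠ s in nhds (0 : ℝ), y + s • v ∈ halfspaceInter T := by
      refine (Filter.eventually_all_finset T).2 fun q hq => ?_
      by_cases hqp : q = p
      · refine Filter.Eventually.of_forall fun s => ?_
        rw [hqp, dotProduct_add, dotProduct_smul, hv, hyp]
        simp
      · have hcont : Continuous fun s : ℝ => q.1 ⬝ᵥ (y + s • v) :=
          (continuous_dotProduct_left q.1).comp (by fun_prop)
        have hlt : q.1 ⬝ᵥ (y + (0 : ℝ) • v) < q.2 := by simpa using hyq q hq hqp
        filter_upwards [hcont.continuousAt.eventually_lt continuousAt_const hlt] with s hs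
        exact hs.le
    obtain ⟨s, hs, hs0⟩ :=
      ((hmem.filter_mono (nhdsWithin_le_nhds (s := Set.Ioi 0))).and
        self_mem_nhdsWithin).exists
    have h := hcd _ hs (by rw [dotProduct_add, dotProduct_smul, hv, hyp]; simp)
    rw [dotProduct_add, dotProduct_smul, hyd, smul_eq_mul, add_eq_left] at h
    exact (mul_eq_zero.1 h).resolve_left (ne_of_gt hs0)
  have hp0 : p.1 ≠ 0 := by
    intro h
    simp [h] at hden
  have hpp := dotProduct_self_pos_of_ne_zero hp0
  set l := c ⬝ᵥ p.1 / p.1 ⬝ᵥ p.1 with hl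
  have hlp : l * p.1 ⬝ᵥ p.1 = c ⬝ᵥ p.1 := div_mul_cancel₀ _ hpp.ne'
  have hw : p.1 ⬝ᵥ (c - l • p.1) = 0 := by
    rw [dotProduct_sub, dotProduct_smul, smul_eq_mul, hlp, dotProduct_comm, sub_self]
  have hcw := hker _ hw
  have hww : (c - l • p.1) ⬝ᵥ (c - l • p.1) = 0 := by
    rw [sub_dotProduct, smul_dotProduct, hw, hcw]
    simp
  have hcl : c = l • p.1 := sub_eq_zero.1 (dotProduct_self_eq_zero.1 hww)
  have hl0 : l ≠ 0 := by
    intro h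
    rw [h, zero_smul] at hcl
    exact hc hcl
  refine ⟨l⁻¹, inv_ne_zero hl0, ?_, ?_⟩
  · conv_rhs => rw [hcl, smul_smul, inv_mul_cancel₀ hl0, one_smul]
  · rw [← hyd, hcl, smul_dotProduct, hyp, smul_eq_mul, ← mul_assoc, inv_mul_cancel₀ hl0, one_mul]

open Classical in
/-- The coefficients `(c, d)` of some hyperplane `c ⬝ᵥ x = d` containing `F`, if there is one. -/
def someHyperplane (F : Set (Fin n → ℝ)) : (Fin n → ℝ) × ℝ :=
  if h : ∃ p : (Fin n → ℝ) × ℝ, p.1 ≠ 0 ∧ ∀ x ∈ F, p.1 ⬝ᵥ x = p.2 then h.choose else 0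

lemma someHyperplane_spec {F : Set (Fin n → ℝ)} {a : Fin n → ℝ} {b : ℝ} (ha : a ≠ 0)
    (hF : ∀ x ∈ F, a ⬝ᵥ x = b) :
    (someHyperplane F).1 ≠ 0 ∧ ∀ x ∈ F, (someHyperplane F).1 ⬝ᵥ x = (someHyperplane F).2 := by
  have h : ∃ p : (Fin n → ℝ) × ℝ, p.1 ≠ 0 ∧ ∀ x ∈ F, p.1 ⬝ᵥ x = p.2 := ⟨(a, b), ha, hF⟩
  rw [someHyperplane, dif_pos h]
  exact h.choose_spec

/-- A full-dimensional polyhedron is cut out by the hyperplanes spanned by its facets. -/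
lemma IsPolyhedron.exists_facet_description {Q : Set (Fin n → ℝ)} (hQ : IsPolyhedron Q)
    (hint : (interior Q).Nonempty) :
    ∃ T, Q = halfspaceInter T ∧ ∀ p ∈ T, ∃ F, IsFace F Q ∧ ∃ r : ℝ,
      p.1 = r • (someHyperplane F).1 ∧ p.2 = r * (someHyperplane F).2 := by
  obtain ⟨T₀, hT₀⟩ := hQ.exists_halfspaceInter
  obtain ⟨T, -, hT, hirr⟩ := exists_irredundant_subset T₀
  obtain ⟨x, hx⟩ := hint
  have hQT : Q = halfspaceInter T := hT₀.trans hT.symm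
  have hxQ : x ∈ halfspaceInter T := hQT ▸ interior_subset hx
  have hne : ∀ p ∈ T, p.1 ≠ 0 := by
    intro p hp h0
    obtain ⟨z, hz, -⟩ := hirr p hp
    have := hxQ p hp
    simp only [h0, zero_dotProduct] at this hz
    linarith
  have hstrict : ∀ p ∈ T, p.1 ⬝ᵥ x < p.2 := fun p hp =>
    dotProduct_lt_of_mem_interior hx (hne p hp) fun y hy => (hQT ▸ hy : y ∈ halfspaceInter T) p hp
  refine ⟨T, hQT, fun p hp => ⟨{y ∈ Q | p.1 ⬝ᵥ y = p.2}, ⟨p.1, p.2, fun y hy =>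
    (hQT ▸ hy : y ∈ halfspaceInter T) p hp, rfl⟩, ?_⟩⟩
  obtain ⟨z, hz, hzT⟩ := hirr p hp
  obtain ⟨h0, hF⟩ := someHyperplane_spec (F := {y ∈ Q | p.1 ⬝ᵥ y = p.2}) (hne p hp)
    fun y hy => hy.2
  obtain ⟨r, -, hr⟩ := exists_smul_eq_of_facet_subset hstrict hp hz hzT h0
    fun y hy hyp => hF y ⟨hQT ▸ hy, hyp⟩
  exact ⟨r, hr⟩

/-- A face of a polyhedron is cut out by turning the inequalities that are tight on it
into equations. -/
lemma IsFace.mem_of_forall_tight {T : Finset ((Fin n → ℝ) × ℝ)} {P : Set (Fin n → ℝ)}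
    (hP : IsFace P (halfspaceInter T)) {x y : Fin n → ℝ} (hx : x ∈ P)
    (hy : y ∈ halfspaceInter T) (htight : ∀ p ∈ T, p.1 ⬝ᵥ x = p.2 → p.1 ⬝ᵥ y = p.2) :
    y ∈ P := by
  obtain ⟨c, d, hc, rfl⟩ := hP
  have hc' : ∀ v ∈ halfspaceInter T, c ⬝ᵥ v ≤ d := hc
  have hcx : c ⬝ᵥ x = d := hx.2
  have hmem : ∀ᶠ t in nhds (0 : ℝ), AffineMap.lineMap x y t ∈ halfspaceInter T := by
    refine (Filter.eventually_all_finset T).2 fun p hp => ?_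
    rcases (hx.1 p hp).lt_or_eq with hlt | heq
    · have hcont : Continuous fun t : ℝ => p.1 ⬝ᵥ (AffineMap.lineMap x y t : Fin n → ℝ) :=
        (continuous_dotProduct_left p.1).comp AffineMap.lineMap_continuous
      have hlt' : p.1 ⬝ᵥ (AffineMap.lineMap x y (0 : ℝ) : Fin n → ℝ) < p.2 := by simpa using hlt
      filter_upwards [hcont.continuousAt.eventually_lt continuousAt_const hlt'] with t ht
      exact ht.le
    · refine Filter.Eventually.of_forall fun t => ?_
      rw [dotProduct_lineMap, htight p hp heq, heq]
      simp
  obtain ⟨t, ht, ht0⟩ :=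
    ((hmem.filter_mono (nhdsWithin_le_nhds (s := Set.Iio 0))).and
      self_mem_nhdsWithin).exists
  have ht0 : t < 0 := ht0
  have h1 := hc' _ ht
  have h2 := hc' _ hy
  rw [dotProduct_lineMap] at h1
  refine ⟨hy, ?_⟩
  change c ⬝ᵥ y = d
  nlinarith

end Polyhedra

section Complexes

variable {n : ℕ} {Pc : Finset (Set (Fin n → ℝ))}

lemma IsPolyhedron.nonempty_intrinsicInterior {P : Set (Fin n → ℝ)} (hP : IsPolyhedron P)
    (hne : P.Nonempty) : (intrinsicInterior ℝ P).Nonempty := by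
  obtain ⟨T, rfl⟩ := hP.exists_halfspaceInter
  exact hne.intrinsicInterior (convex_halfspaceInter T)

lemma IsPolyhedralComplex.subset_iff_mem (hPc : IsPolyhedralComplex Pc)
    {P Q : Set (Fin n → ℝ)} (hP : P ∈ Pc) (hQ : Q ∈ Pc) {x : Fin n → ℝ}
    (hx : x ∈ intrinsicInterior ℝ P) : P ⊆ Q ↔ x ∈ Q := by
  have hxP := intrinsicInterior_subset hx
  refine ⟨fun h => h hxP, fun hxQ => ?_⟩
  exact Set.inter_eq_left.1 ((hPc.2.1 P hP Q hQ).1.eq_of_mem_intrinsicInterior hx ⟨hxP, hxQ⟩)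

lemma IsPolyhedralComplex.exists_mem_intrinsicInterior (hPc : IsPolyhedralComplex Pc)
    (hcov : Covers Pc) (x : Fin n → ℝ) : ∃ P ∈ Pc, x ∈ intrinsicInterior ℝ P := by
  classical
  have hx : x ∈ ⋃₀ (Pc : Set (Set (Fin n → ℝ))) := hcov ▸ Set.mem_univ x
  obtain ⟨P₀, hP₀, hxP₀⟩ := hx
  obtain ⟨P, hP⟩ := (Pc.filter (x ∈ ·)).exists_minimal ⟨P₀, mem_filter.2 ⟨hP₀, hxP₀⟩⟩
  obtain ⟨hPPc, hxP⟩ := mem_filter.1 hP.1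
  refine ⟨P, hPPc, ?_⟩
  obtain ⟨T, rfl⟩ := (hPc.1 P hPPc).exists_halfspaceInter
  refine mem_intrinsicInterior_halfspaceInter hxP fun p hp hpx y hy => ?_
  have hface : IsFace {z ∈ halfspaceInter T | p.1 ⬝ᵥ z = p.2} (halfspaceInter T) :=
    ⟨p.1, p.2, fun z hz => hz p hp, rfl⟩
  exact (hP.2 (mem_filter.2 ⟨hPc.2.2 _ hPPc _ hface, hxP, hpx⟩) (fun z hz => hz.1) hy).2

lemma IsPolyhedralComplex.exists_mem_of_interior_nonempty (hPc : IsPolyhedralComplex Pc)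
    (hcov : Covers Pc) (x : Fin n → ℝ) : ∃ Q ∈ Pc, (interior Q).Nonempty ∧ x ∈ Q := by
  classical
  have hclosed : ∀ P ∈ Pc, IsClosed P := by
    intro P hP
    obtain ⟨T, rfl⟩ := (hPc.1 P hP).exists_halfspaceInter
    exact isClosed_halfspaceInter T
  by_contra! hcon
  have hdense : Dense (⋂ P ∈ {P | P ∈ Pc ∧ interior P = ∅}, Pᶜ) := by
    refine dense_biInter_of_isOpen (fun P hP => (hclosed P hP.1).isOpen_compl) ?_ fun P hP => ?_
    · exact (Pc.finite_toSet.subset fun P hP => hP.1).countable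
    · exact interior_eq_empty_iff_dense_compl.1 hP.2
  have hopen : IsOpen (⋂ P ∈ Pc.filter fun P => (interior P).Nonempty, Pᶜ) :=
    isOpen_biInter_finset fun P hP => (hclosed P (mem_filter.1 hP).1).isOpen_compl
  obtain ⟨y, hy, hy'⟩ := hdense.inter_open_nonempty _ hopen
    ⟨x, by simpa using fun P hP hne => hcon P hP hne⟩
  have hyc : y ∈ ⋃₀ (Pc : Set (Set (Fin n → ℝ))) := hcov ▸ Set.mem_univ y
  obtain ⟨P, hP, hyP⟩ := hyc
  rcases (interior P).eq_empty_or_nonempty with h | h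
  · exact Set.mem_iInter₂.1 hy' P ⟨hP, h⟩ hyP
  · exact Set.mem_iInter₂.1 hy P (mem_filter.2 ⟨hP, h⟩) hyP

/-- The halfspace inequality attached to `F` and a sign, written as `affineForm F s x ≤ 0`. -/
def affineForm (F : Set (Fin n → ℝ)) (s : Bool) (x : Fin n → ℝ) : ℝ :=
  (if s then 1 else -1) * ((someHyperplane F).1 ⬝ᵥ x - (someHyperplane F).2)

lemma IsPolyhedralComplex.mem_iff_forall_affineForm_nonpos (hPc : IsPolyhedralComplex Pc)
    (hcov : Covers Pc) {P : Set (Fin n → ℝ)} (hP : P ∈ Pc) (hne : P.Nonempty)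
    {x : Fin n → ℝ} :
    x ∈ P ↔ ∀ F ∈ Pc, ∀ s, (∀ y ∈ P, affineForm F s y ≤ 0) → affineForm F s x ≤ 0 := by
  refine ⟨fun hx F _ s h => h x hx, fun h => ?_⟩
  have h' : ∀ F ∈ Pc, ∀ r : ℝ,
      (∀ y ∈ P, r * ((someHyperplane F).1 ⬝ᵥ y - (someHyperplane F).2) ≤ 0) →
      r * ((someHyperplane F).1 ⬝ᵥ x - (someHyperplane F).2) ≤ 0 := by
    intro F hF r hr
    rcases lt_trichotomy r 0 with hr0 | rfl | hr0
    · have := h F hF false fun y hy => by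
        have := hr y hy
        simp only [affineForm, Bool.false_eq_true, if_false]
        nlinarith
      simp only [affineForm, Bool.false_eq_true, if_false] at this
      nlinarith
    · simp
    · have := h F hF true fun y hy => by
        have := hr y hy
        simp only [affineForm, if_true]
        nlinarith
      simp only [affineForm, if_true] at this
      nlinarith
  obtain ⟨x₀, hx₀⟩ := (hPc.1 P hP).nonempty_intrinsicInterior hne
  obtain ⟨Q, hQ, hQint, hx₀Q⟩ := hPc.exists_mem_of_interior_nonempty hcov x₀
  have hPQ : P ⊆ Q := (hPc.subset_iff_mem hP hQ hx₀).2 hx₀Q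
  have hface : IsFace P Q := by
    have := (hPc.2.1 P hP Q hQ).2
    rwa [Set.inter_eq_left.2 hPQ] at this
  obtain ⟨T, rfl, hT⟩ := (hPc.1 Q hQ).exists_facet_description hQint
  have hle : ∀ p ∈ T, p.1 ⬝ᵥ x ≤ p.2 := by
    intro p hp
    obtain ⟨F, hF, r, h1, h2⟩ := hT p hp
    have := h' F (hPc.2.2 _ hQ F hF) r fun y hy => by
      have := hPQ hy p hp
      rw [h1, h2, smul_dotProduct, smul_eq_mul] at this
      linarith
    rw [h1, h2, smul_dotProduct, smul_eq_mul]
    linarith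
  refine hface.mem_of_forall_tight (intrinsicInterior_subset hx₀) hle fun p hp hpx => ?_
  refine le_antisymm (hle p hp) ?_
  have htight : ∀ y ∈ P, p.1 ⬝ᵥ y = p.2 := fun y hy =>
    dotProduct_eq_of_mem_intrinsicInterior hx₀ (fun z hz => hPQ hz p hp) hpx hy
  obtain ⟨F, hF, r, h1, h2⟩ := hT p hp
  have := h' F (hPc.2.2 _ hQ F hF) (-r) fun y hy => by
    have := htight y hy
    rw [h1, h2, smul_dotProduct, smul_eq_mul] at this
    linarith
  rw [h1, h2, smul_dotProduct, smul_eq_mul]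
  linarith

end Complexes

open Classical in
/-- Möbius inversion over the up-sets of a finite poset. -/
lemma exists_sum_filter_le_eq {α : Type*} [PartialOrder α] (S : Finset α) (g : α → ℝ) :
    ∃ w : α → ℝ, ∀ p ∈ S, ∑ q ∈ S with p ≤ q, w q = g p := by
  induction S using Finset.strongInduction with
  | H S ih =>
    rcases S.eq_empty_or_nonempty with rfl | hS
    · exact ⟨0, by simp⟩
    obtain ⟨m, hm⟩ := S.exists_minimal hS
    obtain ⟨w, hw⟩ := ih (S.erase m) (erase_ssubset hm.1)
    set w' := Function.update w m (g m - ∑ q ∈ S.erase m with m ≤ q, w q) with hw'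
    have hagree : ∀ p, ∑ q ∈ S.erase m with p ≤ q, w' q = ∑ q ∈ S.erase m with p ≤ q, w q :=
      fun p => sum_congr rfl fun q hq =>
        Function.update_of_ne (ne_of_mem_erase (mem_filter.1 hq).1) _ _
    refine ⟨w', fun p hp => ?_⟩
    rw [← insert_erase hm.1, filter_insert]
    by_cases hpm : p = m
    · subst hpm
      rw [if_pos le_rfl, sum_insert (by simp), hagree]
      simp [hw']
    · rw [if_neg fun h => hpm (h.antisymm (hm.2 hp h)), hagree]
      exact hw p (mem_erase.2 ⟨hpm, hp⟩)

/-- Two-layer networks with neurons indexed by arbitrary finite types. -/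
lemma ltComputes_two_of_fintype {n : ℕ} {ι κ : Type*} [Fintype ι] [Fintype κ]
    (A : ι → Fin n → ℝ) (b : ι → ℝ) (M : κ → ι → ℝ) (e : κ → ℝ) (w : κ → ℝ)
    {f : (Fin n → ℝ) → ℝ}
    (hf : ∀ x, f x = ∑ k, w k * thresh (∑ i, M k i * thresh (A i ⬝ᵥ x + b i) + e k)) :
    LTComputes n 2 (Fintype.card ι + Fintype.card κ) f := by
  let u := (Fintype.equivFin ι).symm
  let v := (Fintype.equivFin κ).symm
  refine ⟨Fintype.card κ, _, fun k => w (v k), 0,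
    Hidden.comp (fun y k => (∑ i, M (v k) (u i) * y i) + e (v k))
      (Hidden.single (fun x i => (∑ j, A (u i) j * x j) + b (u i)) ⟨_, _, fun x j => rfl⟩)
      ⟨_, _, fun x j => rfl⟩, fun x => ?_⟩
  rw [hf, add_zero, ← v.sum_comp]
  refine sum_congr rfl fun k _ => ?_
  rw [← u.sum_comp]
  rfl

lemma thresh_eq_ite_of_iff {t : ℝ} {p : Prop} [Decidable p] (h : 0 < t ↔ p) :
    thresh t = if p then 1 else 0 := by
  simp only [thresh, h]

lemma thresh_nonneg (t : ℝ) : 0 ≤ thresh t := by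
  unfold thresh
  split_ifs <;> norm_num

/-- The conjunction of the negations of a family of threshold values is a threshold of an
affine function of them. -/
lemma sum_thresh_add_one_pos_iff {ι : Type*} [Fintype ι] (S : ι → Prop) [DecidablePred S] (t : ι → ℝ) :
    0 < (∑ i, (if S i then -1 else 0) * thresh (t i)) + 1 ↔ ∀ i, S i → t i ≤ 0 := by
  classical
  have hterm : ∀ i, (if S i then (-1 : ℝ) else 0) * thresh (t i) ≤ 0 := by
    intro i
    have := thresh_nonneg (t i)
    split_ifs <;> linarith
  constructor
  · intro h i hi
    by_contra! hpos
    have hle : ∑ j, (if S j then (-1 : ℝ) else 0) * thresh (t j) ≤ -1 := by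
      calc ∑ j, (if S j then (-1 : ℝ) else 0) * thresh (t j)
          ≤ (if S i then (-1 : ℝ) else 0) * thresh (t i) := by
            rw [← add_sum_erase univ _ (mem_univ i)]
            exact add_le_of_nonpos_right (sum_nonpos fun j _ => hterm j)
        _ = -1 := by simp [thresh, hi, hpos]
    linarith
  · intro h
    rw [sum_eq_zero]
    · norm_num
    · intro i _
      by_cases hi : S i
      · simp [thresh, not_lt.2 (h i hi)]
      · simp [hi]

/-- A compatible complex `Pc` yields a network with `2 * Pc.card` first-layer and `Pc.card`
second-layer neurons. -/
lemma CompatiblePWC.ltComputes {n : ℕ} {f : (Fin n → ℝ) → ℝ}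
    {Pc : Finset (Set (Fin n → ℝ))} (h : CompatiblePWC f Pc) :
    LTComputes n 2 (3 * Pc.card) f := by
  classical
  obtain ⟨hPc, hcov, hconst⟩ := h
  choose! g hg using hconst
  obtain ⟨w, hw⟩ := exists_sum_filter_le_eq Pc g
  have hsum : ∀ x, f x = ∑ P : Pc, w P * if x ∈ (P : Set (Fin n → ℝ)) then 1 else 0 := by
    intro x
    obtain ⟨P, hP, hx⟩ := hPc.exists_mem_intrinsicInterior hcov x
    rw [hg P hP x hx, ← hw P hP, sum_coe_sort Pc fun Q => w Q * if x ∈ Q then 1 else 0,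
      sum_filter]
    refine sum_congr rfl fun Q hQ => ?_
    simp [hPc.subset_iff_mem hP hQ hx]
  have hcard : 3 * Pc.card = Fintype.card (Pc × Bool) + Fintype.card Pc := by
    simp
    ring
  rw [hcard]
  refine ltComputes_two_of_fintype (ι := Pc × Bool) (κ := Pc)
    (fun i => (if i.2 then 1 else -1 : ℝ) • (someHyperplane (i.1 : Set (Fin n → ℝ))).1)
    (fun i => -((if i.2 then 1 else -1 : ℝ) * (someHyperplane (i.1 : Set (Fin n → ℝ))).2))
    (fun P i => if (P : Set (Fin n → ℝ)).Nonempty ∧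
      ∀ y ∈ (P : Set (Fin n → ℝ)), affineForm i.1 i.2 y ≤ 0 then -1 else 0)
    (fun P => if (P : Set (Fin n → ℝ)).Nonempty then 1 else 0) (fun P => w P) fun x => ?_
  rw [hsum]
  refine sum_congr rfl fun P _ => ?_
  have hform : ∀ i : Pc × Bool,
      ((if i.2 then 1 else -1 : ℝ) • (someHyperplane (i.1 : Set (Fin n → ℝ))).1) ⬝ᵥ x
        + -((if i.2 then 1 else -1 : ℝ) * (someHyperplane (i.1 : Set (Fin n → ℝ))).2)
        = affineForm i.1 i.2 x := by
    intro i
    rw [affineForm, smul_dotProduct, smul_eq_mul]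
    ring
  simp only [hform]
  congr 1
  symm
  apply thresh_eq_ite_of_iff
  rcases (P : Set (Fin n → ℝ)).eq_empty_or_nonempty with hP | hP
  · simp [hP]
  · rw [if_pos hP, sum_thresh_add_one_pos_iff (fun i : Pc × Bool => (P : Set (Fin n → ℝ)).Nonempty ∧
        ∀ y ∈ (P : Set (Fin n → ℝ)), affineForm i.1 i.2 y ≤ 0) fun i => affineForm i.1 i.2 x,
      hPc.mem_iff_forall_affineForm_nonpos hcov P.2 hP]
    simp [hP]

/-- every piecewise constant `f : ℝ^n → ℝ` (n ≥ 1) is computed exactly by a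
linear threshold NN with exactly 2 hidden layers, of size at most `3·|Pc*_f|`. -/
theorem stmt_0 (n : ℕ) (hn : 1 ≤ n) (f : (Fin n → ℝ) → ℝ) (hf : IsPWC f) :
    ∃ s : ℕ, LTComputes n 2 s f ∧ s ≤ 3 * minCardPWC f := by
  obtain ⟨Pc, hPc, hcard⟩ := Nat.sInf_mem
    (s := {c : ℕ | ∃ Pc, CompatiblePWC f Pc ∧ Pc.card = c}) (hf.elim fun Pc h => ⟨_, Pc, h, rfl⟩)
  exact ⟨3 * Pc.card, hPc.ltComputes, by rw [hcard]; rfl⟩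
end
end

section
/- For every n ≥ 2, the class of functions computed by one-hidden-layer linear threshold neural networks on ℝ^n is strictly contained in the class computed by two-hidden-layer linear threshold neural networks: there exists a piecewise constant function f : ℝ^n → ℝ that is computed by some linear threshold neural network with 2 hidden layers but by no linear threshold neural network with 1 hidden layer. -/
open Finset MeasureTheory

noncomputable section

open Filter Topology

/-! ### Networks with one hidden layer -/

theorem Hidden.one_le {n k s w : ℕ} {g : (Fin n → ℝ) → (Fin w → ℝ)} (h : Hidden n k s w g) :
    1 ≤ k := by
  cases h <;> omega

theorem Hidden.exists_affine_of_one {n k s w : ℕ} {g : (Fin n → ℝ) → (Fin w → ℝ)}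
    (h : Hidden n k s w g) (hk : k = 1) :
    ∃ T : (Fin n → ℝ) → (Fin w → ℝ), IsAffineMap T ∧ g = fun x j => thresh (T x j) := by
  cases h with
  | single T hT => exact ⟨T, hT, rfl⟩
  | comp T hg hT =>
    have := hg.one_le
    omega

theorem eventually_thresh_add_mul {p r : ℝ} (hr : r ≠ 0) :
    ∀ᶠ ε in 𝓝[>] (0 : ℝ), thresh (p * ε + r) = thresh r := by
  have hc : Tendsto (fun ε : ℝ => p * ε + r) (𝓝[>] 0) (𝓝 r) := by
    have : Tendsto (fun ε : ℝ => p * ε + r) (𝓝 0) (𝓝 (p * 0 + r)) :=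
      Continuous.tendsto (by fun_prop) 0
    rw [mul_zero, zero_add] at this
    exact this.mono_left nhdsWithin_le_nhds
  rcases hr.lt_or_gt with h | h
  · filter_upwards [hc.eventually_lt_const h] with ε hε
    simp [thresh, hε.not_gt, h.not_gt]
  · filter_upwards [hc.eventually_const_lt h] with ε hε
    simp [thresh, hε, h]

/-- The jump of a threshold neuron across the line `x = 0` does not depend on the generic
point of the line near the origin where it is measured. -/
theorem eventually_thresh_jump (p q c : ℝ) :
    ∀ᶠ y in 𝓝[≠] (0 : ℝ), ∀ᶠ ε in 𝓝[>] (0 : ℝ),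
      thresh (p * ε + (q * y + c)) - thresh (q * y + c) =
        if q = 0 ∧ c = 0 then thresh p else 0 := by
  by_cases h : q = 0 ∧ c = 0
  · obtain ⟨rfl, rfl⟩ := h
    refine Eventually.of_forall fun y => ?_
    filter_upwards [self_mem_nhdsWithin] with ε hε
    have hε : (0 : ℝ) < ε := hε
    simp [thresh, mul_pos_iff_of_pos_right hε]
  · have key : ∀ᶠ y in 𝓝[≠] (0 : ℝ), q * y + c ≠ 0 := by
      by_cases hc : c = 0
      · have hq : q ≠ 0 := fun hq => h ⟨hq, hc⟩
        filter_upwards [self_mem_nhdsWithin] with y hy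
        simpa [hc, hq] using hy
      · have : Tendsto (fun y : ℝ => q * y + c) (𝓝 0) (𝓝 (q * 0 + c)) :=
          Continuous.tendsto (by fun_prop) 0
        rw [mul_zero, zero_add] at this
        exact (this.mono_left nhdsWithin_le_nhds).eventually_ne hc
    filter_upwards [key] with y hy
    filter_upwards [eventually_thresh_add_mul (p := p) hy] with ε hε
    simp [hε, h]

theorem eventually_sum_thresh_jump {w : ℕ} (a p q c : Fin w → ℝ) :
    ∃ K : ℝ, ∀ᶠ y in 𝓝[≠] (0 : ℝ), ∀ᶠ ε in 𝓝[>] (0 : ℝ),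
      ∑ k, a k * thresh (p k * ε + (q k * y + c k)) - ∑ k, a k * thresh (q k * y + c k) = K := by
  refine ⟨∑ k, a k * if q k = 0 ∧ c k = 0 then thresh (p k) else 0, ?_⟩
  filter_upwards [eventually_all.2 fun k => eventually_thresh_jump (p k) (q k) (c k)] with y hy
  filter_upwards [eventually_all.2 hy] with ε hε
  rw [← Finset.sum_sub_distrib]
  exact Finset.sum_congr rfl fun k _ => by rw [← mul_sub, hε k]

/-! ### The indicator function of an open quadrant -/

/-- The indicator function of the open quadrant `x i > 0`, `x j > 0`. -/
def quadrantIndicator {n : ℕ} (i j : Fin n) (x : Fin n → ℝ) : ℝ :=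
  if 0 < x i ∧ 0 < x j then 1 else 0

theorem not_ltComputes_one_quadrantIndicator {n : ℕ} {i j : Fin n} (hij : i ≠ j) (s : ℕ) :
    ¬ LTComputes n 1 s (quadrantIndicator i j) := by
  rintro ⟨w, g, a, d, hg, hf⟩
  obtain ⟨T, ⟨M, c, hT⟩, rfl⟩ := hg.exists_affine_of_one rfl
  have hplane : ∀ ε y : ℝ, (if 0 < ε ∧ 0 < y then (1 : ℝ) else 0) =
      ∑ k, a k * thresh (M k i * ε + (M k j * y + c k)) + d := by
    intro ε y
    have := hf (Pi.single i ε + Pi.single j y)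
    simpa [quadrantIndicator, hT, mul_add, Finset.sum_add_distrib, Pi.single_apply, hij,
      hij.symm, add_assoc] using this
  obtain ⟨K, hK⟩ := eventually_sum_thresh_jump a (fun k => M k i) (fun k => M k j) c
  have jump : ∀ᶠ y in 𝓝[≠] (0 : ℝ), (if 0 < y then (1 : ℝ) else 0) = K := by
    filter_upwards [hK] with y hy
    obtain ⟨ε, hε, hpos⟩ := (hy.and self_mem_nhdsWithin).exists
    have hpos : (0 : ℝ) < ε := hpos
    have h1 := hplane ε y
    have h0 := hplane 0 y
    simp only [hpos, true_and, lt_irrefl, false_and, if_false, mul_zero, zero_add] at h1 h0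
    linarith
  obtain ⟨y, hy, hy0⟩ := ((jump.filter_mono (nhdsGT_le_nhdsNE 0)).and self_mem_nhdsWithin).exists
  obtain ⟨z, hz, hz0⟩ := ((jump.filter_mono (nhdsLT_le_nhdsNE 0)).and self_mem_nhdsWithin).exists
  have hy0 : (0 : ℝ) < y := hy0
  have hz0 : z < (0 : ℝ) := hz0
  rw [if_pos hy0] at hy
  rw [if_neg hz0.not_gt] at hz
  linarith

theorem ltComputes_two_quadrantIndicator {n : ℕ} (i j : Fin n) :
    LTComputes n 2 3 (quadrantIndicator i j) := by
  have h1 : IsAffineMap fun (x : Fin n → ℝ) (k : Fin 2) => x (![i, j] k) :=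
    ⟨fun k l => if l = ![i, j] k then 1 else 0, 0, fun x k => by simp⟩
  have h2 : IsAffineMap fun (u : Fin 2 → ℝ) (_ : Fin 1) => u 0 + u 1 - 3 / 2 :=
    ⟨fun _ _ => 1, fun _ => -(3 / 2), fun u _ => by simp [sub_eq_add_neg]⟩
  refine ⟨1, _, fun _ => 1, 0, Hidden.comp _ (Hidden.single _ h1) h2, fun x => ?_⟩
  by_cases hi : 0 < x i <;> by_cases hj : 0 < x j <;>
    norm_num [quadrantIndicator, thresh, hi, hj]

/-! ### The quadrant complex -/

/-- The set of real numbers of weak sign `s`. -/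
def weakSign (s : SignType) : Set ℝ :=
  {r | (s ≠ 1 → r ≤ 0) ∧ (s ≠ -1 → 0 ≤ r)}

theorem mem_weakSign {s : SignType} {r : ℝ} :
    r ∈ weakSign s ↔ (s ≠ 1 → r ≤ 0) ∧ (s ≠ -1 → 0 ≤ r) := Iff.rfl

@[simp]
theorem zero_mem_weakSign (s : SignType) : (0 : ℝ) ∈ weakSign s := by
  simp [mem_weakSign]

theorem weakSign_inter (s u : SignType) :
    weakSign s ∩ weakSign u = weakSign (if s = u then s else 0) := by
  ext r
  cases s <;> cases u <;> simp [mem_weakSign, and_comm]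

theorem mul_mem_weakSign {s : SignType} {a r : ℝ} (ha : 0 ≤ a) (hr : r ∈ weakSign s) :
    a * r ∈ weakSign s :=
  ⟨fun h => mul_nonpos_of_nonneg_of_nonpos ha (hr.1 h), fun h => mul_nonneg ha (hr.2 h)⟩

theorem exists_mem_weakSign (r : ℝ) : ∃ s, r ∈ weakSign s := by
  rcases le_total r 0 with h | h
  · exact ⟨-1, by simp [mem_weakSign, h]⟩
  · exact ⟨1, by simp [mem_weakSign, h]⟩

/-- Every linear form that is nonpositive on `weakSign s` cuts out `weakSign s` or
`weakSign 0` from it. -/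
theorem mem_weakSign_and_mul_eq_zero (s : SignType) (c r : ℝ) :
    (r ∈ weakSign s ∧ c * r = 0) ↔ r ∈ weakSign (if c = 0 then s else 0) := by
  split_ifs with hc
  · simp [hc]
  · have : r ∈ weakSign 0 ↔ r = 0 := by
      rw [mem_weakSign, le_antisymm_iff]
      simp
    rw [this]
    constructor
    · rintro ⟨-, h⟩
      exact (mul_eq_zero.1 h).resolve_left hc
    · rintro rfl
      simp

/-- Both `weakSign s` and `weakSign 0` are cut out from `weakSign s` by linear forms that are
nonpositive on it. -/
theorem exists_mul_nonpos_weakSign (s : SignType) (p : Prop) [Decidable p] :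
    ∃ c : ℝ, (∀ r ∈ weakSign s, c * r ≤ 0) ∧
      ∀ r, (r ∈ weakSign s ∧ c * r = 0) ↔ r ∈ weakSign (if p then s else 0) := by
  refine ⟨if p then 0 else -(s : ℝ), ?_, fun r => ?_⟩
  · intro r hr
    rw [mem_weakSign] at hr
    by_cases hp : p <;> cases s <;> simp_all
  · by_cases hp : p
    · simp [hp]
    · rw [mem_weakSign_and_mul_eq_zero]
      cases s <;> simp [hp]

/-- The set of points whose coordinates `i` and `j` have weak signs `s` and `t`. -/
def signCell {n : ℕ} (i j : Fin n) (s t : SignType) : Set (Fin n → ℝ) :=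
  {x | x i ∈ weakSign s ∧ x j ∈ weakSign t}

theorem mem_signCell {n : ℕ} {i j : Fin n} {s t : SignType} {x : Fin n → ℝ} :
    x ∈ signCell i j s t ↔ x i ∈ weakSign s ∧ x j ∈ weakSign t := Iff.rfl

theorem isPolyhedron_signCell {n : ℕ} (i j : Fin n) (s t : SignType) :
    IsPolyhedron (signCell i j s t) := by
  refine ⟨4, ![Pi.single i (if s = 1 then 0 else 1), Pi.single i (if s = -1 then 0 else -1),
    Pi.single j (if t = 1 then 0 else 1), Pi.single j (if t = -1 then 0 else -1)], 0, ?_⟩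
  ext x
  simp only [mem_signCell, mem_weakSign, Set.mem_ofPred_eq, Fin.forall_fin_succ]
  cases s <;> cases t <;> simp [Pi.single_apply, and_assoc]

theorem isPolyhedron_empty {n : ℕ} : IsPolyhedron (∅ : Set (Fin n → ℝ)) :=
  ⟨1, 0, fun _ => -1, by ext x; simp⟩

theorem isFace_empty {n : ℕ} (P : Set (Fin n → ℝ)) : IsFace ∅ P :=
  ⟨0, 1, by simp, by simp⟩

theorem signCell_inter {n : ℕ} (i j : Fin n) (s t u v : SignType) :
    signCell i j s t ∩ signCell i j u v =
      signCell i j (if s = u then s else 0) (if t = v then t else 0) := by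
  ext x
  simp only [Set.mem_inter_iff, mem_signCell, ← weakSign_inter]
  tauto

theorem isFace_signCell_ite {n : ℕ} {i j : Fin n} (s t : SignType) (p q : Prop)
    [Decidable p] [Decidable q] :
    IsFace (signCell i j (if p then s else 0) (if q then t else 0)) (signCell i j s t) := by
  obtain ⟨a, ha, ha'⟩ := exists_mul_nonpos_weakSign s p
  obtain ⟨b, hb, hb'⟩ := exists_mul_nonpos_weakSign t q
  have hsum : ∀ x : Fin n → ℝ,
      ∑ k, (Pi.single i a + Pi.single j b : Fin n → ℝ) k * x k = a * x i + b * x j := by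
    intro x
    simp [add_mul, Finset.sum_add_distrib, Pi.single_apply]
  refine ⟨Pi.single i a + Pi.single j b, 0, fun x hx => ?_, ?_⟩
  · rw [hsum]
    exact add_nonpos (ha _ hx.1) (hb _ hx.2)
  · ext x
    simp only [Set.mem_ofPred_eq, hsum, mem_signCell, ← ha', ← hb']
    constructor
    · rintro ⟨⟨h1, h2⟩, h3, h4⟩
      exact ⟨⟨h1, h3⟩, by rw [h2, h4, add_zero]⟩
    · rintro ⟨⟨h1, h2⟩, h3⟩
      have := ha _ h1
      have := hb _ h2
      exact ⟨⟨h1, by linarith⟩, h2, by linarith⟩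

theorem isFace_signCell {n : ℕ} {i j : Fin n} (hij : i ≠ j) {s t : SignType}
    {F : Set (Fin n → ℝ)} (hF : IsFace F (signCell i j s t)) :
    F = ∅ ∨ ∃ u v, F = signCell i j u v := by
  obtain ⟨c, d, hle, rfl⟩ := hF
  refine or_iff_not_imp_left.2 fun hne => ?_
  obtain ⟨y, hy, hyd⟩ := Set.nonempty_iff_ne_empty.2 hne
  obtain rfl : d = 0 := by
    have h0 := hle 0 (by simp [mem_signCell])
    have h2 := hle (fun k => 2 * y k)
      ⟨mul_mem_weakSign zero_le_two hy.1, mul_mem_weakSign zero_le_two hy.2⟩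
    simp only [Pi.zero_apply, mul_zero, Finset.sum_const_zero] at h0
    simp only [mul_left_comm _ (2 : ℝ), ← Finset.mul_sum] at h2
    linarith
  have hi : ∀ r ∈ weakSign s, c i * r ≤ 0 := by
    intro r hr
    have := hle (Pi.single i r) (by simp [mem_signCell, hr, hij.symm])
    simpa [Pi.single_apply] using this
  have hj : ∀ r ∈ weakSign t, c j * r ≤ 0 := by
    intro r hr
    have := hle (Pi.single j r) (by simp [mem_signCell, hr, hij])
    simpa [Pi.single_apply] using this
  have hsum : ∀ x : Fin n → ℝ, ∑ k, c k * x k = c i * x i + c j * x j := by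
    intro x
    have h1 := hle (x - Pi.single i (x i) - Pi.single j (x j))
      (by simp [mem_signCell, hij, hij.symm])
    have h2 := hle (-(x - Pi.single i (x i) - Pi.single j (x j)))
      (by simp [mem_signCell, hij, hij.symm])
    simp only [Pi.neg_apply, Pi.sub_apply, mul_neg, mul_sub, Finset.sum_neg_distrib,
      Finset.sum_sub_distrib, Pi.single_apply, mul_ite, mul_zero, Finset.sum_ite_eq',
      Finset.mem_univ, if_true] at h1 h2
    linarith
  refine ⟨if c i = 0 then s else 0, if c j = 0 then t else 0, ?_⟩
  ext x
  simp only [Set.mem_ofPred_eq, hsum, mem_signCell, ← mem_weakSign_and_mul_eq_zero]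
  constructor
  · rintro ⟨⟨h1, h2⟩, h3⟩
    have := hi _ h1
    have := hj _ h2
    exact ⟨⟨h1, by linarith⟩, h2, by linarith⟩
  · rintro ⟨⟨h1, h2⟩, h3, h4⟩
    exact ⟨⟨h1, h3⟩, by rw [h2, h4, add_zero]⟩

/-- The segment from `y ∈ P` to a point `x` of the relative interior of `P` can be prolonged
inside `P` beyond `x`. -/
theorem exists_pos_add_smul_sub_mem {E : Type*} [NormedAddCommGroup E] [NormedSpace ℝ E]
    {P : Set E} {x y : E} (hx : x ∈ intrinsicInterior ℝ P) (hy : y ∈ P) :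
    ∃ ε : ℝ, 0 < ε ∧ x + ε • (x - y) ∈ P := by
  obtain ⟨z, hz, rfl⟩ := mem_intrinsicInterior.1 hx
  have hmem : ∀ ε : ℝ, (z : E) + ε • ((z : E) - y) ∈ affineSpan ℝ P := by
    intro ε
    have := AffineMap.lineMap_mem (1 + ε) (subset_affineSpan ℝ P hy) z.2
    rw [AffineMap.lineMap_apply_module'] at this
    convert this using 1
    module
  have hcont : Tendsto (fun ε : ℝ => (⟨_, hmem ε⟩ : affineSpan ℝ P)) (𝓝 0) (𝓝 z) := by
    have : Continuous fun ε : ℝ => (⟨_, hmem ε⟩ : affineSpan ℝ P) := by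
      fun_prop
    convert this.tendsto 0 using 2
    ext
    simp
  have hev := (hcont.mono_left (nhdsWithin_le_nhds (s := Set.Ioi 0))).eventually
    (mem_interior_iff_mem_nhds.1 hz : _ ∈ 𝓝 z)
  obtain ⟨ε, hε, hpos⟩ := (hev.and self_mem_nhdsWithin).exists
  exact ⟨ε, hpos, hε⟩

theorem pos_of_mem_intrinsicInterior_signCell_one {n : ℕ} {i j : Fin n} {x : Fin n → ℝ}
    (hx : x ∈ intrinsicInterior ℝ (signCell i j 1 1)) : 0 < x i ∧ 0 < x j := by
  obtain ⟨ε, hε, h⟩ := exists_pos_add_smul_sub_mem hx (y := fun _ => 1)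
    (by simp [mem_signCell, mem_weakSign])
  simp only [mem_signCell, mem_weakSign, ne_eq, not_true_eq_false, false_imp_iff, true_and,
    Pi.add_apply, Pi.smul_apply, Pi.sub_apply, smul_eq_mul] at h
  have h := And.intro (h.1 (by decide)) (h.2 (by decide))
  constructor <;> nlinarith

theorem exists_eq_quadrantIndicator_of_mem_intrinsicInterior {n : ℕ} (i j : Fin n)
    (s t : SignType) :
    ∃ c : ℝ, ∀ x ∈ intrinsicInterior ℝ (signCell i j s t), quadrantIndicator i j x = c := by
  by_cases h : s = 1 ∧ t = 1
  · obtain ⟨rfl, rfl⟩ := h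
    exact ⟨1, fun x hx => if_pos (pos_of_mem_intrinsicInterior_signCell_one hx)⟩
  · refine ⟨0, fun x hx => if_neg fun hpos => h ?_⟩
    have hx := intrinsicInterior_subset hx
    exact ⟨by_contra fun hs => (hx.1.1 hs).not_gt hpos.1,
      by_contra fun ht => (hx.2.1 ht).not_gt hpos.2⟩

open Classical in
/-- The subdivision of `ℝ^n` by the hyperplanes `x i = 0` and `x j = 0`. -/
def quadrantComplex {n : ℕ} (i j : Fin n) : Finset (Set (Fin n → ℝ)) :=
  insert ∅ (Finset.univ.image fun p : SignType × SignType => signCell i j p.1 p.2)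

theorem mem_quadrantComplex {n : ℕ} {i j : Fin n} {P : Set (Fin n → ℝ)} :
    P ∈ quadrantComplex i j ↔ P = ∅ ∨ ∃ s t, P = signCell i j s t := by
  simp [quadrantComplex, eq_comm]

theorem isPolyhedralComplex_quadrantComplex {n : ℕ} {i j : Fin n} (hij : i ≠ j) :
    IsPolyhedralComplex (quadrantComplex i j) := by
  simp only [IsPolyhedralComplex, mem_quadrantComplex]
  refine ⟨?_, ?_, ?_⟩
  · rintro P (rfl | ⟨s, t, rfl⟩)
    · exact isPolyhedron_empty
    · exact isPolyhedron_signCell i j s t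
  · rintro P (rfl | ⟨s, t, rfl⟩) Q (rfl | ⟨u, v, rfl⟩)
    iterate 3 simp only [Set.empty_inter, Set.inter_empty, isFace_empty, and_self]
    refine ⟨?_, ?_⟩
    · rw [signCell_inter]
      exact isFace_signCell_ite s t _ _
    · rw [Set.inter_comm, signCell_inter]
      exact isFace_signCell_ite u v _ _
  · rintro P (rfl | ⟨s, t, rfl⟩) F hF
    · obtain ⟨c, d, -, rfl⟩ := hF
      simp
    · exact isFace_signCell hij hF

theorem covers_quadrantComplex {n : ℕ} (i j : Fin n) : Covers (quadrantComplex i j) := by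
  refine Set.eq_univ_of_forall fun x => ?_
  obtain ⟨s, hs⟩ := exists_mem_weakSign (x i)
  obtain ⟨t, ht⟩ := exists_mem_weakSign (x j)
  exact ⟨signCell i j s t, mem_quadrantComplex.2 (Or.inr ⟨s, t, rfl⟩), hs, ht⟩

theorem isPWC_quadrantIndicator {n : ℕ} {i j : Fin n} (hij : i ≠ j) :
    IsPWC (quadrantIndicator i j) := by
  refine ⟨quadrantComplex i j, isPolyhedralComplex_quadrantComplex hij,
    covers_quadrantComplex i j, fun P hP => ?_⟩
  rcases mem_quadrantComplex.1 hP with rfl | ⟨s, t, rfl⟩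
  · exact ⟨0, by simp⟩
  · exact exists_eq_quadrantIndicator_of_mem_intrinsicInterior i j s t

/-- for every `n ≥ 2` there is a piecewise constant `f : ℝ^n → ℝ` computed by
some linear threshold NN with 2 hidden layers but by no linear threshold NN with 1 hidden
layer. -/
theorem stmt_3 (n : ℕ) (hn : 2 ≤ n) :
    ∃ f : (Fin n → ℝ) → ℝ, IsPWC f ∧ (∃ s : ℕ, LTComputes n 2 s f) ∧
      ¬ ∃ s : ℕ, LTComputes n 1 s f := by
  have hij : (⟨0, by omega⟩ : Fin n) ≠ ⟨1, by omega⟩ := by simp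
  exact ⟨_, isPWC_quadrantIndicator hij, ⟨3, ltComputes_two_quadrantIndicator _ _⟩,
    fun ⟨s, hs⟩ => not_ltComputes_one_quadrantIndicator hij s hs⟩
end
end

section
/- Let 𝒫 be a finite polyhedral complex in ℝ^n whose union of all members equals ℝ^n. Then for every nonempty polyhedron F ∈ 𝒫 of dimension k with 0 ≤ k ≤ n, there exist n − k + 1 pairwise distinct full-dimensional polyhedra in 𝒫 whose common intersection equals F. -/
open Finset MeasureTheory

noncomputable section

/-- The linear functional with coefficient vector `a`. -/
def coeffFunctional {n : ℕ} (a : Fin n → ℝ) : (Fin n → ℝ) →ₗ[ℝ] ℝ :=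
  ∑ j, a j • LinearMap.proj j

theorem coeffFunctional_apply {n : ℕ} (a x : Fin n → ℝ) :
    coeffFunctional a x = ∑ j, a j * x j := by
  simp [coeffFunctional]

theorem IsFace.exists_functional {n : ℕ} {F P : Set (Fin n → ℝ)} (h : IsFace F P) :
    ∃ (f : (Fin n → ℝ) →ₗ[ℝ] ℝ) (d : ℝ),
      (∀ x ∈ P, f x ≤ d) ∧ ∀ x, x ∈ F ↔ x ∈ P ∧ f x = d := by
  obtain ⟨c, d, h1, rfl⟩ := h
  refine ⟨coeffFunctional c, d, ?_, ?_⟩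
  · simpa only [coeffFunctional_apply] using h1
  · simp [coeffFunctional_apply]

theorem IsPolyhedron.convex {n : ℕ} {P : Set (Fin n → ℝ)} (h : IsPolyhedron P) :
    Convex ℝ P := by
  obtain ⟨m, a, b, rfl⟩ := h
  simp only [← coeffFunctional_apply, Set.ofPred_forall]
  exact convex_iInter fun i => convex_halfSpace_le (coeffFunctional (a i)).isLinear (b i)

theorem IsPolyhedron.isClosed {n : ℕ} {P : Set (Fin n → ℝ)} (h : IsPolyhedron P) :
    IsClosed P := by
  obtain ⟨m, a, b, rfl⟩ := h
  simp only [Set.ofPred_forall]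
  exact isClosed_iInter fun i => isClosed_le (by fun_prop) continuous_const

/-- A point `x` of `F` from which segments in `F` ending at `x` can be prolonged within `F`. -/
def IsProlongable {n : ℕ} (F : Set (Fin n → ℝ)) (x : Fin n → ℝ) : Prop :=
  x ∈ F ∧ ∀ y ∈ F, ∃ ε : ℝ, 0 < ε ∧ x + ε • (x - y) ∈ F

theorem Convex.exists_isProlongable {n : ℕ} {F : Set (Fin n → ℝ)} (hF : Convex ℝ F)
    (hne : F.Nonempty) : ∃ x, IsProlongable F x := by
  obtain ⟨x, hx⟩ := hne.intrinsicInterior hF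
  have hxF := intrinsicInterior_subset hx
  refine ⟨x, hxF, fun y hy => ?_⟩
  obtain ⟨z, hz, rfl⟩ := mem_intrinsicInterior.1 hx
  have hmem : ∀ ε : ℝ, (z : Fin n → ℝ) + ε • ((z : Fin n → ℝ) - y) ∈ affineSpan ℝ F := fun ε => by
    have := AffineMap.lineMap_mem (Q := affineSpan ℝ F) (-ε) z.2 (subset_affineSpan ℝ F hy)
    convert this using 1
    simp [AffineMap.lineMap_apply]
    module
  let γ : ℝ → affineSpan ℝ F := fun ε => ⟨_, hmem ε⟩
  have hγ : Continuous γ := by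
    apply Continuous.subtype_mk
    fun_prop
  have h0 : γ 0 = z := Subtype.ext (by simp [γ])
  have hev : ∀ᶠ ε in nhds (0 : ℝ), γ ε ∈ interior ((↑) ⁻¹' F : Set (affineSpan ℝ F)) :=
    hγ.continuousAt.eventually_mem (isOpen_interior.mem_nhds (by rwa [h0]))
  obtain ⟨ε, h1, h2⟩ := ((hev.filter_mono (nhdsWithin_le_nhds (s := Set.Ioi 0))).and
    self_mem_nhdsWithin).exists
  exact ⟨ε, h2, (interior_subset h1 : γ ε ∈ ((↑) ⁻¹' F : Set (affineSpan ℝ F)))⟩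

theorem IsPolyhedralComplex.subset_of_isProlongable {n : ℕ} {Pc : Finset (Set (Fin n → ℝ))}
    (hPc : IsPolyhedralComplex Pc) {F Q : Set (Fin n → ℝ)} (hF : F ∈ Pc) (hQ : Q ∈ Pc)
    {x : Fin n → ℝ} (hx : IsProlongable F x) (hxQ : x ∈ Q) : F ⊆ Q := by
  obtain ⟨f, d, hle, hmem⟩ := (hPc.2.1 F hF Q hQ).1.exists_functional
  intro y hy
  obtain ⟨ε, hε, hz⟩ := hx.2 y hy
  have hfx := ((hmem x).1 ⟨hx.1, hxQ⟩).2
  have hfz := hle _ hz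
  have hfy := hle y hy
  simp only [map_add, map_smul, map_sub, smul_eq_mul] at hfz
  have : f y = d := by
    by_contra hne
    have : 0 < ε * (f x - f y) := mul_pos hε (by rw [hfx]; exact sub_pos.2 (lt_of_le_of_ne hfy hne))
    linarith
  exact ((hmem y).2 ⟨hy, this⟩).2

theorem Covers.exists_full_dim_mem {n : ℕ} {Pc : Finset (Set (Fin n → ℝ))}
    (hPc : IsPolyhedralComplex Pc) (hcov : Covers Pc) (z : Fin n → ℝ) :
    ∃ P ∈ Pc, polyDim P = n ∧ z ∈ P := by
  by_contra! hz
  let U : Set (Fin n → ℝ) := (⋃ P ∈ Pc.filter (fun P => polyDim P = n), P)ᶜ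
  have hU : IsOpen U := by
    refine (isClosed_biUnion_finset fun P hP => ?_).isOpen_compl
    exact (hPc.1 P (Finset.mem_filter.1 hP).1).isClosed
  have hnull : volume U = 0 := by
    refine measure_mono_null (t := ⋃ P ∈ Pc.filter (fun P => polyDim P ≠ n), P) ?_ ?_
    · intro w hw
      have hw' : w ∈ ⋃₀ (Pc : Set (Set (Fin n → ℝ))) := by rw [hcov]; trivial
      obtain ⟨P, hP, hwP⟩ := hw'
      simp only [Set.mem_iUnion, Finset.mem_filter, exists_prop]
      refine ⟨P, ⟨hP, fun hd => hw ?_⟩, hwP⟩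
      simp only [Set.mem_iUnion, Finset.mem_filter, exists_prop]
      exact ⟨P, ⟨hP, hd⟩, hwP⟩
    · refine (measure_biUnion_null_iff (Finset.countable_toSet _)).2 fun P hP => ?_
      refine measure_mono_null (subset_affineSpan ℝ P) (Measure.addHaar_affineSubspace _ _ ?_)
      intro htop
      refine (Finset.mem_filter.1 hP).2 ?_
      rw [polyDim, htop, AffineSubspace.direction_top]
      simp
  have hempty := (hU.measure_eq_zero_iff volume).1 hnull
  have hzU : z ∈ U := by
    simp only [U, Set.mem_compl_iff, Set.mem_iUnion, Finset.mem_filter, exists_prop]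
    rintro ⟨P, ⟨hP, hd⟩, hzP⟩
    exact hz P hP hd hzP
  rw [hempty] at hzU
  exact hzU

theorem Covers.exists_full_dim_mem_direction {n : ℕ} {Pc : Finset (Set (Fin n → ℝ))}
    (hPc : IsPolyhedralComplex Pc) (hcov : Covers Pc) (x u : Fin n → ℝ) :
    ∃ P ∈ Pc, polyDim P = n ∧ x ∈ P ∧ ∃ ε : ℝ, 0 < ε ∧ x + ε • u ∈ P := by
  by_contra! hcon
  have hev : ∀ P ∈ Pc, polyDim P = n →
      ∀ᶠ ε in nhdsWithin (0 : ℝ) (Set.Ioi 0), x + ε • u ∉ P := by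
    intro P hP hd
    by_cases hx : x ∈ P
    · filter_upwards [self_mem_nhdsWithin] with ε hε using hcon P hP hd hx ε hε
    · have hc : Continuous fun ε : ℝ => x + ε • u := by fun_prop
      exact (hc.continuousAt.eventually_mem ((hPc.1 P hP).isClosed.isOpen_compl.mem_nhds
        (by simpa using hx))).filter_mono nhdsWithin_le_nhds
  have hall : ∀ᶠ ε in nhdsWithin (0 : ℝ) (Set.Ioi 0),
      ∀ P ∈ Pc, polyDim P = n → x + ε • u ∉ P := by
    refine (Filter.eventually_all_finset Pc).2 fun P hP => ?_
    by_cases hd : polyDim P = n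
    · filter_upwards [hev P hP hd] with ε hε _ using hε
    · simp [hd]
  obtain ⟨ε, hε⟩ := hall.exists
  obtain ⟨P, hP, hd, hmem⟩ := hcov.exists_full_dim_mem hPc (x + ε • u)
  exact hε P hP hd hmem

theorem LinearMap.eq_zero_of_mem_vectorSpan {n : ℕ} {F : Set (Fin n → ℝ)}
    {f : (Fin n → ℝ) →ₗ[ℝ] ℝ} {d : ℝ} (h : ∀ x ∈ F, f x = d) {v : Fin n → ℝ}
    (hv : v ∈ vectorSpan ℝ F) : f v = 0 := by
  have hle : vectorSpan ℝ F ≤ LinearMap.ker f := by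
    refine Submodule.span_le.2 ?_
    rintro _ ⟨a, ha, b, hb, rfl⟩
    simp [h a ha, h b hb]
  exact hle hv

/-- The segment from a point `w₀` of a polyhedron to a point `w₁` outside it leaves the polyhedron
through one of the violated constraints. -/
theorem exists_exit_point {n m : ℕ} (f : Fin m → (Fin n → ℝ) →ₗ[ℝ] ℝ) (b : Fin m → ℝ)
    {w₀ w₁ : Fin n → ℝ} (h₀ : ∀ i, f i w₀ ≤ b i) (h₁ : ∃ i, b i < f i w₁) :
    ∃ t : ℝ, 0 ≤ t ∧ t ≤ 1 ∧ (∀ i, f i (w₀ + t • (w₁ - w₀)) ≤ b i) ∧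
      ∃ i, b i < f i w₁ ∧ f i (w₀ + t • (w₁ - w₀)) = b i := by
  let τ : Fin m → ℝ := fun i => (b i - f i w₀) / (f i w₁ - f i w₀)
  obtain ⟨i, hi, hmin⟩ := Finset.exists_min_image
    (Finset.univ.filter fun i => b i < f i w₁) τ (by
      obtain ⟨i, hi⟩ := h₁
      exact ⟨i, by simpa using hi⟩)
  simp only [Finset.mem_filter, Finset.mem_univ, true_and] at hi hmin
  have hpos : ∀ j, b j < f j w₁ → 0 < f j w₁ - f j w₀ := fun j hj => by linarith [h₀ j]
  have ht0 : 0 ≤ τ i := div_nonneg (by linarith [h₀ i]) (hpos i hi).le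
  have ht1 : τ i ≤ 1 := (div_le_one (hpos i hi)).2 (by linarith)
  refine ⟨τ i, ht0, ht1, fun j => ?_, i, hi, ?_⟩
  · simp only [map_add, map_smul, map_sub, smul_eq_mul]
    by_cases hj : b j < f j w₁
    · have := (le_div_iff₀ (hpos j hj)).1 (hmin j hj)
      linarith
    · nlinarith [h₀ j, not_lt.1 hj]
  · simp only [map_add, map_smul, map_sub, smul_eq_mul]
    have : τ i * (f i w₁ - f i w₀) = b i - f i w₀ := div_mul_cancel₀ _ (hpos i hi).ne'
    linarith

theorem IsPolyhedralComplex.sub_notMem_vectorSpan {n : ℕ} {Pc : Finset (Set (Fin n → ℝ))}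
    (hPc : IsPolyhedralComplex Pc) {F G : Set (Fin n → ℝ)} (hF : F ∈ Pc) (hG : G ∈ Pc)
    (hFG : F ⊆ G) {x y : Fin n → ℝ} (hx : x ∈ F) (hyG : y ∈ G) (hyF : y ∉ F) :
    y - x ∉ vectorSpan ℝ F := by
  obtain ⟨f, d, -, hmem⟩ := (hPc.2.1 F hF G hG).2.exists_functional
  rw [Set.inter_eq_left.2 hFG] at hmem
  intro hv
  have h0 := LinearMap.eq_zero_of_mem_vectorSpan (fun z hz => ((hmem z).1 hz).2) hv
  rw [map_sub, ((hmem x).1 hx).2, sub_eq_zero] at h0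
  exact hyF ((hmem y).2 ⟨hyG, h0⟩)

/-- A member minimal among those strictly containing `F` has dimension one more than `F`. -/
theorem IsPolyhedralComplex.vectorSpan_le_of_minimal {n : ℕ} {Pc : Finset (Set (Fin n → ℝ))}
    (hPc : IsPolyhedralComplex Pc) {F G : Set (Fin n → ℝ)} (hF : F ∈ Pc) (hG : G ∈ Pc)
    (hFG : F ⊆ G) (hmin : ∀ H ∈ Pc, F ⊂ H → ¬ H ⊂ G) {x y : Fin n → ℝ}
    (hx : IsProlongable F x) (hyG : y ∈ G) (hyF : y ∉ F) :
    vectorSpan ℝ G ≤ vectorSpan ℝ F ⊔ Submodule.span ℝ {y - x} := by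
  intro v hvG
  by_contra hv
  obtain ⟨f, d, hle, hmem⟩ := (hPc.2.1 F hF G hG).2.exists_functional
  rw [Set.inter_eq_left.2 hFG] at hmem
  have hfx := ((hmem x).1 hx.1).2
  have hfy : f y < d := lt_of_le_of_ne (hle y hyG) fun h => hyF ((hmem y).2 ⟨hyG, h⟩)
  obtain ⟨δ, hδ, hfδ⟩ : ∃ δ : ℝ, 0 < δ ∧ 0 < f (-(y - x) + δ • v) := by
    have hc : Filter.Tendsto (fun δ : ℝ => (d - f y) + δ * f v) (nhds 0)
        (nhds ((d - f y) + 0 * f v)) := Continuous.tendsto (by fun_prop) 0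
    have hev := (hc.eventually_const_lt (u := 0) (by linarith)).filter_mono
      (nhdsWithin_le_nhds (s := Set.Ioi 0))
    obtain ⟨δ, h1, h2⟩ := (hev.and self_mem_nhdsWithin).exists
    refine ⟨δ, h2, ?_⟩
    simp only [map_add, map_neg, map_sub, map_smul, smul_eq_mul, hfx]
    linarith
  set u := -(y - x) + δ • v with hu
  obtain ⟨m, a, b, hGeq⟩ := hPc.1 G hG
  let g : Fin m → (Fin n → ℝ) →ₗ[ℝ] ℝ := fun i => coeffFunctional (a i)
  have hGmem : ∀ w, w ∈ G ↔ ∀ i, g i w ≤ b i := by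
    simp [hGeq, g, coeffFunctional_apply]
  have hxG := (hGmem x).1 (hFG hx.1)
  obtain ⟨ε, hε, hε1, hslack⟩ : ∃ ε : ℝ, 0 < ε ∧ ε < 1 ∧
      ∀ i, g i x < b i → g i (x + ε • u) < b i := by
    have hev : ∀ᶠ ε in nhds (0 : ℝ), ∀ i, g i x < b i → g i (x + ε • u) < b i := by
      refine Filter.eventually_all.2 fun i => ?_
      by_cases hi : g i x < b i
      · have hc : Filter.Tendsto (fun ε : ℝ => g i x + ε * g i u) (nhds 0)
            (nhds (g i x + 0 * g i u)) := Continuous.tendsto (by fun_prop) 0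
        filter_upwards [hc.eventually_lt_const (u := b i) (by linarith)] with ε h _
        simpa using h
      · simp [hi]
    obtain ⟨ε, ⟨h1, h2⟩, h3⟩ := (((hev.and (eventually_lt_nhds one_pos)).filter_mono
      (nhdsWithin_le_nhds (s := Set.Ioi 0))).and self_mem_nhdsWithin).exists
    exact ⟨ε, h3, h2, h1⟩
  have hw₀ : x + ε • (y - x) ∈ G :=
    (hPc.1 G hG).convex.add_smul_sub_mem (hFG hx.1) hyG ⟨hε.le, hε1.le⟩
  have hw₁ : x + ε • u ∉ G := fun h => by
    have := hle _ h
    simp only [map_add f x, map_smul f ε, smul_eq_mul, hfx] at this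
    linarith [mul_pos hε hfδ]
  obtain ⟨t, ht0, ht1, hw, i, hi, hwi⟩ := exists_exit_point g b ((hGmem _).1 hw₀)
    (by
      rw [hGmem] at hw₁
      push Not at hw₁
      exact hw₁)
  set w := x + ε • (y - x) + t • (x + ε • u - (x + ε • (y - x))) with hwdef
  have hix : g i x = b i := by
    by_contra hne
    exact lt_asymm hi (hslack i (lt_of_le_of_ne (hxG i) hne))
  have hH : IsFace {z ∈ G | (∑ j, a i j * z j) = b i} G :=
    ⟨a i, b i, fun z hz => by simpa [g, coeffFunctional_apply] using (hGmem z).1 hz i, rfl⟩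
  have hHP := hPc.2.2 G hG _ hH
  have hHmem : ∀ z, z ∈ {z ∈ G | (∑ j, a i j * z j) = b i} ↔ z ∈ G ∧ g i z = b i := by
    simp [g, coeffFunctional_apply]
  generalize {z ∈ G | (∑ j, a i j * z j) = b i} = H at hHP hHmem
  have hFH : F ⊆ H := hPc.subset_of_isProlongable hF hHP hx ((hHmem x).2 ⟨hFG hx.1, hix⟩)
  have hwH : w ∈ H := (hHmem w).2 ⟨(hGmem w).2 hw, hwi⟩
  have hwF : w ∉ F := fun h => by
    have hD : w - x ∈ vectorSpan ℝ F := vsub_mem_vectorSpan ℝ h hx.1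
    have hwx : w - x = (ε * (1 - 2 * t)) • (y - x) + (ε * t * δ) • v := by
      rw [hwdef, hu]; module
    rw [hwx] at hD
    rcases ht0.eq_or_lt with h0 | h0
    · subst h0
      simp only [mul_zero, sub_zero, mul_one, zero_mul, zero_smul, add_zero] at hD
      exact hPc.sub_notMem_vectorSpan hF hG hFG hx.1 hyG hyF
        ((Submodule.smul_mem_iff _ hε.ne').1 hD)
    · refine hv ((Submodule.smul_mem_iff _ (mul_pos (mul_pos hε h0) hδ).ne').1 ?_)
      have h1 := Submodule.mem_sup_left (T := Submodule.span ℝ {y - x}) hD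
      have h2 := Submodule.smul_mem _ (ε * (1 - 2 * t)) (Submodule.mem_sup_right
        (S := vectorSpan ℝ F) (Submodule.mem_span_singleton_self (R := ℝ) (y - x)))
      exact (Submodule.add_mem_iff_right _ h2).1 h1
  refine hmin H hHP ⟨hFH, fun h => hwF (h hwH)⟩ ⟨fun z hz => ((hHmem z).1 hz).1, fun hGH => ?_⟩
  have hconst : ∀ z ∈ G, g i z = b i := fun z hz => ((hHmem z).1 (hGH hz)).2
  have hgv := LinearMap.eq_zero_of_mem_vectorSpan hconst hvG
  simp only [hu, map_add, map_smul, map_neg, map_sub, hconst y hyG, hix, hgv, smul_eq_mul] at hi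
  simp at hi

theorem IsPolyhedralComplex.polyDim_of_minimal {n : ℕ} {Pc : Finset (Set (Fin n → ℝ))}
    (hPc : IsPolyhedralComplex Pc) {F G : Set (Fin n → ℝ)} (hF : F ∈ Pc) (hG : G ∈ Pc)
    (hFG : F ⊂ G) (hmin : ∀ H ∈ Pc, F ⊂ H → ¬ H ⊂ G) {x : Fin n → ℝ}
    (hx : IsProlongable F x) : polyDim G = polyDim F + 1 := by
  obtain ⟨y, hyG, hyF⟩ := Set.exists_of_ssubset hFG
  have hle := hPc.vectorSpan_le_of_minimal hF hG hFG.1 hmin hx hyG hyF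
  have hnot := hPc.sub_notMem_vectorSpan hF hG hFG.1 hx.1 hyG hyF
  have heq : vectorSpan ℝ G = vectorSpan ℝ F ⊔ Submodule.span ℝ {y - x} := by
    refine le_antisymm hle (sup_le (vectorSpan_mono ℝ hFG.1) ?_)
    rw [Submodule.span_singleton_le_iff_mem]
    exact vsub_mem_vectorSpan ℝ hyG (hFG.1 hx.1)
  rw [polyDim, polyDim, direction_affineSpan, direction_affineSpan, heq]
  have hne : y - x ≠ 0 := fun h => hnot (h ▸ Submodule.zero_mem _)
  have hdisj : vectorSpan ℝ F ⊓ Submodule.span ℝ {y - x} = ⊥ :=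
    ((Submodule.disjoint_span_singleton' hne).2 hnot).eq_bot
  have := Submodule.finrank_sup_add_finrank_inf_eq (vectorSpan ℝ F) (Submodule.span ℝ {y - x})
  rw [hdisj, finrank_bot, finrank_span_singleton hne] at this
  simpa using this

/-- Some full-dimensional member meets `G` exactly in `F`, when `G` is minimal among the members
strictly containing `F`. -/
theorem IsPolyhedralComplex.exists_full_dim_inter_eq {n : ℕ} {Pc : Finset (Set (Fin n → ℝ))}
    (hPc : IsPolyhedralComplex Pc) (hcov : Covers Pc) {F G : Set (Fin n → ℝ)} (hF : F ∈ Pc)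
    (hG : G ∈ Pc) (hFG : F ⊂ G) (hmin : ∀ H ∈ Pc, F ⊂ H → ¬ H ⊂ G) {x : Fin n → ℝ}
    (hx : IsProlongable F x) : ∃ P ∈ Pc, polyDim P = n ∧ P ∩ G = F := by
  obtain ⟨y, hyG, hyF⟩ := Set.exists_of_ssubset hFG
  obtain ⟨P, hP, hd, hxP, ε, hε, hz⟩ := hcov.exists_full_dim_mem_direction hPc x (x - y)
  have hFP := hPc.subset_of_isProlongable hF hP hx hxP
  have hyP : y ∉ P := fun hyP => by
    obtain ⟨f, d, hle, hmem⟩ := (hPc.2.1 F hF P hP).2.exists_functional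
    rw [Set.inter_eq_left.2 hFP] at hmem
    have hfz := hle _ hz
    have hfx := ((hmem x).1 hx.1).2
    have hfy : f y < d := lt_of_le_of_ne (hle y hyP) fun h => hyF ((hmem y).2 ⟨hyP, h⟩)
    simp only [map_add, map_smul, map_sub, smul_eq_mul, hfx] at hfz
    linarith [mul_pos hε (sub_pos.2 hfy)]
  refine ⟨P, hP, hd, Set.Subset.antisymm (fun z hz => ?_) (Set.subset_inter hFP hFG.1)⟩
  by_contra hzF
  obtain ⟨f, d, -, hmem⟩ := (hPc.2.1 P hP G hG).2.exists_functional
  have hle := hPc.vectorSpan_le_of_minimal hF hG hFG.1 hmin hx hz.2 hzF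
  have hfx := ((hmem x).1 ⟨hxP, hFG.1 hx.1⟩).2
  have hker : vectorSpan ℝ F ⊔ Submodule.span ℝ {z - x} ≤ LinearMap.ker f := by
    refine sup_le (fun v hv => LinearMap.eq_zero_of_mem_vectorSpan
      (fun w hw => ((hmem w).1 ⟨hFP hw, hFG.1 hw⟩).2) hv) ?_
    rw [Submodule.span_singleton_le_iff_mem, LinearMap.mem_ker, map_sub, hfx,
      ((hmem z).1 hz).2, sub_self]
  have hfy : f (y - x) = 0 := hker (hle (vsub_mem_vectorSpan ℝ hyG (hFG.1 hx.1)))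
  rw [map_sub, hfx, sub_eq_zero] at hfy
  exact hyP ((hmem y).2 ⟨hyG, hfy⟩).1

theorem IsPolyhedralComplex.exists_full_dim_sInter_eq {n : ℕ} {Pc : Finset (Set (Fin n → ℝ))}
    (hPc : IsPolyhedralComplex Pc) (hcov : Covers Pc) (m : ℕ) :
    ∀ F ∈ Pc, F.Nonempty → polyDim F + m = n →
      ∃ S : Finset (Set (Fin n → ℝ)), S ⊆ Pc ∧ (∀ P ∈ S, polyDim P = n) ∧
        S.card = m + 1 ∧ ⋂₀ (S : Set (Set (Fin n → ℝ))) = F := by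
  classical
  induction m with
  | zero => exact fun F hF _ hdim => ⟨{F}, by simpa using hF, by simpa using hdim, by simp⟩
  | succ m ih =>
    intro F hF hne hdim
    obtain ⟨x, hx⟩ := (hPc.1 F hF).convex.exists_isProlongable hne
    obtain ⟨Q, hQ, hQd, hxQ, -⟩ := hcov.exists_full_dim_mem_direction hPc x 0
    have hFQ : F ⊂ Q := (hPc.subset_of_isProlongable hF hQ hx hxQ).ssubset_of_ne
      (by rintro rfl; omega)
    obtain ⟨G, hGmin⟩ := (Pc.filter fun G => F ⊂ G).exists_minimal
      ⟨Q, Finset.mem_filter.2 ⟨hQ, hFQ⟩⟩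
    obtain ⟨hG, hFG⟩ := Finset.mem_filter.1 hGmin.prop
    have hmin : ∀ H ∈ Pc, F ⊂ H → ¬ H ⊂ G := fun H hH hFH hlt =>
      hGmin.not_lt (Finset.mem_filter.2 ⟨hH, hFH⟩) hlt
    have hGd := hPc.polyDim_of_minimal hF hG hFG hmin hx
    obtain ⟨S, hS, hSd, hcard, hSG⟩ := ih G hG (hne.mono hFG.1) (by omega)
    obtain ⟨P, hP, hPd, hPG⟩ := hPc.exists_full_dim_inter_eq hcov hF hG hFG hmin hx
    have hPS : P ∉ S := fun h => hFG.2 (by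
      rw [← hPG]
      exact Set.subset_inter (hSG ▸ Set.sInter_subset_of_mem h) subset_rfl)
    refine ⟨insert P S, Finset.insert_subset hP hS, ?_, ?_, ?_⟩
    · simpa [hPd] using hSd
    · rw [Finset.card_insert_of_notMem hPS, hcard]
    · rw [Finset.coe_insert, Set.sInter_insert, hSG, hPG]

/-- in a polyhedral complex covering `ℝ^n`, every nonempty `k`-dimensional
member `F` is the intersection of `n - k + 1` pairwise distinct full-dimensional members. -/
theorem stmt_13 (n k : ℕ) (Pc : Finset (Set (Fin n → ℝ)))
    (hPc : IsPolyhedralComplex Pc) (hcov : Covers Pc)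
    (F : Set (Fin n → ℝ)) (hF : F ∈ Pc) (hFne : F.Nonempty)
    (hdim : polyDim F = k) (hkn : k ≤ n) :
    ∃ S : Finset (Set (Fin n → ℝ)), S ⊆ Pc ∧ (∀ P ∈ S, polyDim P = n) ∧
      S.card = n - k + 1 ∧ ⋂₀ (S : Set (Set (Fin n → ℝ))) = F := by
  exact hPc.exists_full_dim_sInter_eq hcov (n - k) F hF hFne (by omega)
end
end
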